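/- For a constant-rate source, the effective capacity C_E1 is twice differentiable at snr = 0 with C_E1'(0) = E[X]/log_e 2 and C_E1''(0) = −(θ/(log_e 2)²)·Var(X) − E[Y]/log_e 2, where X = δ·(z1 − z2)·1{z1 ≥ z2} and Y = δ²·(z1² − z2²)·1{z1 ≥ z2}; consequently the wideband slope equals S₀ = −2·(C_E1'(0))²·log_e 2 / C_E1''(0) = 2·(E[X])² / ((θ/log_e 2)·Var(X) + E[Y]). -/

import Mathlib

open MeasureTheory ProbabilityTheory Filter Set

noncomputable def wsF (k a b s : ℝ) : ℝ :=
  Real.exp (-k * (Real.log (1 + a * s) - Real.log (1 + b * s)))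

noncomputable def wsD (a b s : ℝ) : ℝ := a / (1 + a * s) - b / (1 + b * s)

noncomputable def wsE (a b s : ℝ) : ℝ := a ^ 2 / (1 + a * s) ^ 2 - b ^ 2 / (1 + b * s) ^ 2

noncomputable def wsF1 (k a b s : ℝ) : ℝ := -k * wsD a b s * wsF k a b s

noncomputable def wsF2 (k a b s : ℝ) : ℝ :=
  (k ^ 2 * wsD a b s ^ 2 + k * wsE a b s) * wsF k a b s

lemma ws_half {a M s : ℝ} (ha : 0 ≤ a) (haM : a ≤ M) (hs : |s| < 1 / (2 * (M + 1))) :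
    1 / 2 ≤ 1 + a * s ∧ 1 + a * s ≤ 2 := by
  have h1 : |a * s| ≤ 1 / 2 := by
    rw [abs_mul, abs_of_nonneg ha]
    have hM : 0 < M + 1 := by linarith
    rw [lt_div_iff₀ (by positivity)] at hs
    nlinarith [abs_nonneg s, mul_le_mul_of_nonneg_right haM (abs_nonneg s)]
  rw [abs_le] at h1
  constructor <;> linarith [h1.1, h1.2]

lemma ws_div {a M s : ℝ} (ha : 0 ≤ a) (haM : a ≤ M) (hs : |s| < 1 / (2 * (M + 1))) :
    0 ≤ a / (1 + a * s) ∧ a / (1 + a * s) ≤ 2 * M := by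
  obtain ⟨h, -⟩ := ws_half ha haM hs
  have hp : 0 < 1 + a * s := by linarith
  refine ⟨by positivity, ?_⟩
  rw [div_le_iff₀ hp]
  nlinarith

lemma ws_log {x : ℝ} (h : 1 / 2 ≤ x) (h2 : x ≤ 2) : |Real.log x| ≤ 1 := by
  have hx : 0 < x := by linarith
  rw [abs_le]
  constructor
  · have := Real.one_sub_inv_le_log_of_pos hx
    have h3 : x⁻¹ ≤ 2 := by
      rw [inv_le_comm₀ hx (by norm_num)]; linarith
    linarith
  · linarith [Real.log_le_sub_one_of_pos hx]

lemma wsF_bound {k a b M s : ℝ} (hk : 0 < k) (ha : 0 ≤ a) (haM : a ≤ M) (hb : 0 ≤ b)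
    (hbM : b ≤ M) (hs : |s| < 1 / (2 * (M + 1))) : |wsF k a b s| ≤ Real.exp (2 * k) := by
  unfold wsF
  rw [Real.abs_exp, Real.exp_le_exp]
  obtain ⟨h1, h2⟩ := ws_half ha haM hs
  obtain ⟨h3, h4⟩ := ws_half hb hbM hs
  have h5 := abs_le.1 (ws_log h1 h2)
  have h6 := abs_le.1 (ws_log h3 h4)
  nlinarith [h5.1, h5.2, h6.1, h6.2]

lemma wsD_bound {a b M s : ℝ} (ha : 0 ≤ a) (haM : a ≤ M) (hb : 0 ≤ b)
    (hbM : b ≤ M) (hs : |s| < 1 / (2 * (M + 1))) : |wsD a b s| ≤ 2 * M := by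
  unfold wsD
  have h1 := ws_div ha haM hs
  have h2 := ws_div hb hbM hs
  rw [abs_le]
  constructor <;> linarith [h1.1, h1.2, h2.1, h2.2]

lemma wsE_bound {a b M s : ℝ} (ha : 0 ≤ a) (haM : a ≤ M) (hb : 0 ≤ b)
    (hbM : b ≤ M) (hs : |s| < 1 / (2 * (M + 1))) : |wsE a b s| ≤ (2 * M) ^ 2 := by
  unfold wsE
  have h1 := ws_div ha haM hs
  have h2 := ws_div hb hbM hs
  rw [← div_pow, ← div_pow]
  have h3 := pow_le_pow_left₀ h1.1 h1.2 2
  have h4 := pow_le_pow_left₀ h2.1 h2.2 2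
  rw [abs_le]
  constructor <;> nlinarith [sq_nonneg (a / (1 + a * s)), sq_nonneg (b / (1 + b * s))]

lemma wsF1_bound {k a b M s : ℝ} (hk : 0 < k) (ha : 0 ≤ a) (haM : a ≤ M) (hb : 0 ≤ b)
    (hbM : b ≤ M) (hs : |s| < 1 / (2 * (M + 1))) :
    |wsF1 k a b s| ≤ k * (2 * M) * Real.exp (2 * k) := by
  unfold wsF1
  rw [abs_mul, abs_mul, abs_neg, abs_of_pos hk]
  have hM : 0 ≤ M := ha.trans haM
  gcongr
  · exact wsD_bound ha haM hb hbM hs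
  · exact wsF_bound hk ha haM hb hbM hs

lemma wsF2_bound {k a b M s : ℝ} (hk : 0 < k) (ha : 0 ≤ a) (haM : a ≤ M) (hb : 0 ≤ b)
    (hbM : b ≤ M) (hs : |s| < 1 / (2 * (M + 1))) :
    |wsF2 k a b s| ≤ (k ^ 2 * (2 * M) ^ 2 + k * (2 * M) ^ 2) * Real.exp (2 * k) := by
  unfold wsF2
  rw [abs_mul]
  have hM : 0 ≤ M := ha.trans haM
  gcongr
  · refine (abs_add_le _ _).trans ?_
    rw [abs_mul, abs_mul, abs_of_pos hk, abs_pow, abs_pow, abs_of_pos hk]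
    gcongr
    · exact wsD_bound ha haM hb hbM hs
    · exact wsE_bound ha haM hb hbM hs
  · exact wsF_bound hk ha haM hb hbM hs

lemma wsF_deriv {k a b s : ℝ} (h1 : 0 < 1 + a * s) (h2 : 0 < 1 + b * s) :
    HasDerivAt (wsF k a b) (wsF1 k a b s) s := by
  have e1 : HasDerivAt (fun s => 1 + a * s) a s := by
    simpa using ((hasDerivAt_id s).const_mul a).const_add 1
  have e2 : HasDerivAt (fun s => 1 + b * s) b s := by
    simpa using ((hasDerivAt_id s).const_mul b).const_add 1
  have := (((e1.log h1.ne').sub (e2.log h2.ne')).const_mul (-k)).exp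
  refine HasDerivAt.congr_deriv this ?_
  simp only [wsF1, wsD, wsF, Pi.sub_apply]
  ring

lemma wsF1_deriv {k a b s : ℝ} (h1 : 0 < 1 + a * s) (h2 : 0 < 1 + b * s) :
    HasDerivAt (wsF1 k a b) (wsF2 k a b s) s := by
  have e1 : HasDerivAt (fun s => 1 + a * s) a s := by
    simpa using ((hasDerivAt_id s).const_mul a).const_add 1
  have e2 : HasDerivAt (fun s => 1 + b * s) b s := by
    simpa using ((hasDerivAt_id s).const_mul b).const_add 1
  have hD : HasDerivAt (wsD a b) (-wsE a b s) s := by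
    have := ((hasDerivAt_const s a).div e1 h1.ne').sub ((hasDerivAt_const s b).div e2 h2.ne')
    refine HasDerivAt.congr_deriv this ?_
    simp only [wsE]
    ring
  refine HasDerivAt.congr_deriv ((hD.const_mul (-k)).mul (wsF_deriv (k := k) h1 h2)) ?_
  simp only [wsF1, wsF2]
  ring

lemma ws_under_integral {Ω : Type*} [MeasurableSpace Ω] (μ : Measure Ω) [IsProbabilityMeasure μ]
    (F F' : ℝ → Ω → ℝ) (ε B C : ℝ) (hF : ∀ s, Measurable (F s)) (hF' : ∀ s, Measurable (F' s))
    (hB : ∀ s, |s| < ε → ∀ ω, |F s ω| ≤ B) (hC : ∀ s, |s| < ε → ∀ ω, |F' s ω| ≤ C)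
    (hd : ∀ s, |s| < ε → ∀ ω, HasDerivAt (fun t => F t ω) (F' s ω) s) (s : ℝ) (hs : |s| < ε) :
    HasDerivAt (fun t => ∫ ω, F t ω ∂μ) (∫ ω, F' s ω ∂μ) s := by
  have hmem : Metric.ball (0 : ℝ) ε ∈ nhds s :=
    Metric.isOpen_ball.mem_nhds (by simpa using hs)
  refine (hasDerivAt_integral_of_dominated_loc_of_deriv_le (μ := μ) (F := F) (F' := F')
    (bound := fun _ => C) hmem
    (Eventually.of_forall fun t => (hF t).aestronglyMeasurable) ?_
    (hF' s).aestronglyMeasurable ?_ (integrable_const C) ?_).2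
  · exact Integrable.of_bound (hF s).aestronglyMeasurable B
      (Eventually.of_forall fun ω => hB s hs ω)
  · exact Eventually.of_forall fun ω t ht => hC t (by simpa using ht) ω
  · exact Eventually.of_forall fun ω t ht => hd t (by simpa using ht) ω

/-- For a constant-rate source, the effective capacity `C_E1` is twice
differentiable (from the right) at `snr = 0` with `C_E1'(0) = E[X]/log 2` and
`C_E1''(0) = −(θ/(log 2)²)·Var(X) − E[Y]/log 2`, where
`X = δ·(z1 − z2)·1{z1 ≥ z2}` and `Y = δ²·(z1² − z2²)·1{z1 ≥ z2}`; consequently the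
wideband slope equals
`S₀ = −2·(C_E1'(0))²·log 2 / C_E1''(0) = 2·(E[X])² / ((θ/log 2)·Var(X) + E[Y])`. -/
theorem wideband_slope_confidential_constant_rate
    {Ω : Type*} [MeasurableSpace Ω] (μ : Measure Ω) [IsProbabilityMeasure μ]
    (z1 z2 : Ω → ℝ) (hz1m : Measurable z1) (hz2m : Measurable z2)
    (hz1nn : ∀ ω, 0 ≤ z1 ω) (hz2nn : ∀ ω, 0 ≤ z2 ω)
    (M : ℝ) (hz1b : ∀ ω, z1 ω ≤ M) (hz2b : ∀ ω, z2 ω ≤ M)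
    (hpos : 0 < (μ {ω | z2 ω < z1 ω}).toReal)
    (θ δ : ℝ) (hθ : 0 < θ) (hδ0 : 0 < δ) (hδ1 : δ ≤ 1)
    (R1 : ℝ → Ω → ℝ)
    (hR1 : ∀ snr ω, R1 snr ω =
      if z2 ω ≤ z1 ω then
        Real.logb 2 ((1 + δ * snr * z1 ω) / (1 + δ * snr * z2 ω)) else 0)
    (g1 : ℝ → ℝ) (hg1 : ∀ snr, g1 snr = ∫ ω, Real.exp (-θ * R1 snr ω) ∂μ)
    (CE1 : ℝ → ℝ) (hCE1 : ∀ snr, CE1 snr = -(1 / θ) * Real.log (g1 snr))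
    (X Y : Ω → ℝ)
    (hX : ∀ ω, X ω = if z2 ω ≤ z1 ω then δ * (z1 ω - z2 ω) else 0)
    (hY : ∀ ω, Y ω = if z2 ω ≤ z1 ω then δ ^ 2 * ((z1 ω) ^ 2 - (z2 ω) ^ 2) else 0)
    (VarX : ℝ) (hVarX : VarX = (∫ ω, (X ω) ^ 2 ∂μ) - (∫ ω, X ω ∂μ) ^ 2) :
    (∃ CE1' : ℝ → ℝ,
      (∀ᶠ snr in nhdsWithin 0 (Set.Ici 0), HasDerivWithinAt CE1 (CE1' snr) (Set.Ici 0) snr) ∧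
      CE1' 0 = (∫ ω, X ω ∂μ) / Real.log 2 ∧
      HasDerivWithinAt CE1'
        (-(θ / (Real.log 2) ^ 2) * VarX - (∫ ω, Y ω ∂μ) / Real.log 2)
        (Set.Ici 0) 0) ∧
    -2 * ((∫ ω, X ω ∂μ) / Real.log 2) ^ 2 * Real.log 2 /
        (-(θ / (Real.log 2) ^ 2) * VarX - (∫ ω, Y ω ∂μ) / Real.log 2)
      = 2 * (∫ ω, X ω ∂μ) ^ 2 / ((θ / Real.log 2) * VarX + ∫ ω, Y ω ∂μ) := by
  have hl2 : 0 < Real.log 2 := Real.log_pos (by norm_num)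
  constructor
  swap
  · have h : -(θ / (Real.log 2) ^ 2) * VarX - (∫ ω, Y ω ∂μ) / Real.log 2
        = -(((θ / Real.log 2) * VarX + ∫ ω, Y ω ∂μ) / Real.log 2) := by
      field_simp
      ring
    rw [h]
    by_cases h0 : (θ / Real.log 2) * VarX + ∫ ω, Y ω ∂μ = 0
    · simp [h0]
    · generalize (θ / Real.log 2) * VarX + ∫ ω, Y ω ∂μ = D at h0
      field_simp
  set k : ℝ := θ / Real.log 2 with hk
  have hkpos : 0 < k := div_pos hθ hl2
  set a : Ω → ℝ := fun ω => if z2 ω ≤ z1 ω then δ * z1 ω else 0 with ha_def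
  set b : Ω → ℝ := fun ω => if z2 ω ≤ z1 ω then δ * z2 ω else 0 with hb_def
  have hset : MeasurableSet {ω | z2 ω ≤ z1 ω} := measurableSet_le hz2m hz1m
  have ham : Measurable a := Measurable.ite hset (hz1m.const_mul δ) measurable_const
  have hbm : Measurable b := Measurable.ite hset (hz2m.const_mul δ) measurable_const
  have hM : ∀ ω : Ω, 0 ≤ M := fun ω => (hz1nn ω).trans (hz1b ω)
  have ha0 : ∀ ω, 0 ≤ a ω := by
    intro ω
    simp only [ha_def]
    split_ifs
    · exact mul_nonneg hδ0.le (hz1nn ω)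
    · exact le_rfl
  have hb0 : ∀ ω, 0 ≤ b ω := by
    intro ω
    simp only [hb_def]
    split_ifs
    · exact mul_nonneg hδ0.le (hz2nn ω)
    · exact le_rfl
  have haM : ∀ ω, a ω ≤ M := by
    intro ω
    simp only [ha_def]
    split_ifs
    · nlinarith [hz1nn ω, hz1b ω]
    · exact hM ω
  have hbM : ∀ ω, b ω ≤ M := by
    intro ω
    simp only [hb_def]
    split_ifs
    · nlinarith [hz2nn ω, hz2b ω]
    · exact hM ω
  have hXa : ∀ ω, X ω = a ω - b ω := by
    intro ω
    rw [hX]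
    simp only [ha_def, hb_def]
    split_ifs <;> ring
  have hYa : ∀ ω, Y ω = a ω ^ 2 - b ω ^ 2 := by
    intro ω
    rw [hY]
    simp only [ha_def, hb_def]
    split_ifs <;> ring
  have hM0 : 0 ≤ M := by
    obtain ⟨ω⟩ : Nonempty Ω := nonempty_of_isProbabilityMeasure μ
    exact hM ω
  set ε : ℝ := 1 / (2 * (M + 1)) with hε
  have hεpos : 0 < ε := by positivity
  have hap : ∀ s, |s| < ε → ∀ ω, 0 < 1 + a ω * s := fun s hs ω => by
    linarith [(ws_half (ha0 ω) (haM ω) hs).1]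
  have hbp : ∀ s, |s| < ε → ∀ ω, 0 < 1 + b ω * s := fun s hs ω => by
    linarith [(ws_half (hb0 ω) (hbM ω) hs).1]
  have hDm : ∀ s, Measurable fun ω => wsD (a ω) (b ω) s := by
    intro s; unfold wsD; fun_prop
  have hEm : ∀ s, Measurable fun ω => wsE (a ω) (b ω) s := by
    intro s; unfold wsE; fun_prop
  have hFm : ∀ s, Measurable fun ω => wsF k (a ω) (b ω) s := by
    intro s; unfold wsF; fun_prop
  have hF1m : ∀ s, Measurable fun ω => wsF1 k (a ω) (b ω) s := by
    intro s; exact ((hDm s).const_mul (-k)).mul (hFm s)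
  have hF2m : ∀ s, Measurable fun ω => wsF2 k (a ω) (b ω) s := by
    intro s
    exact ((((hDm s).pow_const 2).const_mul (k ^ 2)).add ((hEm s).const_mul k)).mul (hFm s)
  have hG1 := ws_under_integral μ (fun s ω => wsF k (a ω) (b ω) s)
    (fun s ω => wsF1 k (a ω) (b ω) s) ε _ _ hFm hF1m
    (fun s hs ω => wsF_bound hkpos (ha0 ω) (haM ω) (hb0 ω) (hbM ω) hs)
    (fun s hs ω => wsF1_bound hkpos (ha0 ω) (haM ω) (hb0 ω) (hbM ω) hs)
    (fun s hs ω => wsF_deriv (hap s hs ω) (hbp s hs ω))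
  have hG2 := ws_under_integral μ (fun s ω => wsF1 k (a ω) (b ω) s)
    (fun s ω => wsF2 k (a ω) (b ω) s) ε _ _ hF1m hF2m
    (fun s hs ω => wsF1_bound hkpos (ha0 ω) (haM ω) (hb0 ω) (hbM ω) hs)
    (fun s hs ω => wsF2_bound hkpos (ha0 ω) (haM ω) (hb0 ω) (hbM ω) hs)
    (fun s hs ω => wsF1_deriv (hap s hs ω) (hbp s hs ω))
  set G : ℝ → ℝ := fun s => ∫ ω, wsF k (a ω) (b ω) s ∂μ with hGdef
  set G1 : ℝ → ℝ := fun s => ∫ ω, wsF1 k (a ω) (b ω) s ∂μ with hG1def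
  have hGpos : ∀ s, |s| < ε → 0 < G s := by
    intro s hs
    exact integral_exp_pos (Integrable.of_bound (hFm s).aestronglyMeasurable (Real.exp (2 * k))
      (Eventually.of_forall fun ω => wsF_bound hkpos (ha0 ω) (haM ω) (hb0 ω) (hbM ω) hs))
  have hgG : ∀ s, |s| < ε → g1 s = G s := by
    intro s hs
    rw [hg1]
    refine integral_congr_ae (Eventually.of_forall fun ω => ?_)
    have h1 := hap s hs ω
    have h2 := hbp s hs ω
    simp only [wsF, hR1]
    congr 1
    simp only [ha_def, hb_def] at h1 h2 ⊢
    split_ifs with hc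
    · simp only [hc, if_true] at h1 h2
      rw [show δ * s * z1 ω = δ * z1 ω * s by ring, show δ * s * z2 ω = δ * z2 ω * s by ring,
        Real.logb, Real.log_div h1.ne' h2.ne', hk]
      ring
    · simp
  have hball : ∀ s, |s| < ε → ∀ᶠ t in nhds s, |t| < ε := fun s hs =>
    (continuous_abs.tendsto s).eventually (gt_mem_nhds hs)
  have h0 : |(0 : ℝ)| < ε := by simpa using hεpos
  have hG0 : G 0 = 1 := by simp [hGdef, wsF]
  have hG10 : G1 0 = -k * ∫ ω, X ω ∂μ := by
    simp only [hG1def, wsF1, wsD, wsF, hXa]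
    rw [← integral_const_mul]
    simp
  have hX2i : Integrable (fun ω => (X ω) ^ 2) μ := by
    refine Integrable.of_bound (C := (M : ℝ) ^ 2) ?_ (Eventually.of_forall fun ω => ?_)
    · simp only [hXa]
      exact ((ham.sub hbm).pow_const 2).aestronglyMeasurable
    · rw [Real.norm_eq_abs, abs_pow]
      gcongr
      rw [hXa, abs_le]
      constructor <;> linarith [ha0 ω, hb0 ω, haM ω, hbM ω]
  have hYi : Integrable Y μ := by
    refine Integrable.of_bound (C := (M : ℝ) ^ 2) ?_ (Eventually.of_forall fun ω => ?_)
    · rw [show Y = fun ω => a ω ^ 2 - b ω ^ 2 from funext hYa]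
      exact ((ham.pow_const 2).sub (hbm.pow_const 2)).aestronglyMeasurable
    · rw [Real.norm_eq_abs, hYa, abs_le]
      constructor <;> nlinarith [ha0 ω, hb0 ω, haM ω, hbM ω]
  have hG20 : (∫ ω, wsF2 k (a ω) (b ω) 0 ∂μ) =
      k ^ 2 * (∫ ω, (X ω) ^ 2 ∂μ) + k * ∫ ω, Y ω ∂μ := by
    rw [← integral_const_mul, ← integral_const_mul,
      ← integral_add (hX2i.const_mul _) (hYi.const_mul _)]
    refine integral_congr_ae (Eventually.of_forall fun ω => ?_)
    simp [wsF2, wsD, wsE, wsF, hXa, hYa]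
  refine ⟨fun s => -(1 / θ) * (G1 s / G s), ?_, ?_, ?_⟩
  · refine nhdsWithin_le_nhds ?_
    filter_upwards [hball 0 h0] with s hs
    have hd := ((hG1 s hs).log (hGpos s hs).ne').const_mul (-(1 / θ))
    refine (hd.congr_of_eventuallyEq ?_).hasDerivWithinAt
    filter_upwards [hball s hs] with t ht
    rw [hCE1, hgG t ht]
  · simp only [hG0, hG10, hk]
    field_simp
  · have hd := ((hG2 0 h0).div (hG1 0 h0) (hGpos 0 h0).ne').const_mul (-(1 / θ))
    refine (hd.congr_deriv ?_).hasDerivWithinAt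
    change -(1 / θ) * (((∫ ω, wsF2 k (a ω) (b ω) 0 ∂μ) * G 0 - G1 0 * G1 0) / G 0 ^ 2) = _
    rw [hG0, hG10, hG20, hVarX, hk]
    field_simp
    ring
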